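/- Let (P_t) be a tracially symmetric quantum Markov semigroup on M_{n₁}(ℂ) satisfying CBE(K,N), and let (Q_t) be a tracially symmetric quantum Markov semigroup on M_{n₂}(ℂ) satisfying CBE(K',N'). Then the tensor product semigroup (P_t ⊗ Q_t) on M_{n₁}(ℂ) ⊗ M_{n₂}(ℂ) ≅ M_{n₁n₂}(ℂ) satisfies CBE(min{K,K'}, N+N'). -/

import Mathlib

open Matrix Filter
open scoped ComplexOrder ENNReal Kronecker

namespace CD

abbrev Mat (ι : Type*) := Matrix ι ι ℂ

variable {ι : Type*}

noncomputable def trn [Fintype ι] (x : Mat ι) : ℂ :=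
  (Fintype.card ι : ℂ)⁻¹ * x.trace

noncomputable def inn [Fintype ι] (x y : Mat ι) : ℂ := trn (xᴴ * y)

def matLE [Fintype ι] (A B : Mat ι) : Prop := (B - A).PosSemidef

def blockify [Fintype ι] {m : ℕ} (B : Fin m → Fin m → Mat ι) :
    Matrix (Fin m × ι) (Fin m × ι) ℂ :=
  Matrix.of fun p q => B p.1 q.1 p.2 q.2

def IsCP [Fintype ι] (Φ : Mat ι →ₗ[ℂ] Mat ι) : Prop :=
  ∀ (m : ℕ) (B : Fin m → Fin m → Mat ι),
    (blockify B).PosSemidef → (blockify fun j k => Φ (B j k)).PosSemidef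

structure QMS (ι : Type*) [Fintype ι] [DecidableEq ι] where
  P : ℝ → Mat ι →ₗ[ℂ] Mat ι
  gen : Mat ι →ₗ[ℂ] Mat ι
  P_zero : P 0 = LinearMap.id
  P_add : ∀ s t : ℝ, P (s + t) = (P s) ∘ₗ (P t)
  P_cp : ∀ t : ℝ, 0 ≤ t → IsCP (P t)
  P_unital : ∀ t : ℝ, 0 ≤ t → P t 1 = 1
  P_cont : ∀ (x : Mat ι) (i j : ι), Continuous fun t : ℝ => P t x i j
  P_deriv : ∀ (x : Mat ι) (i j : ι),
    HasDerivAt (fun t : ℝ => P t x i j) (-(gen x i j)) 0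

variable [Fintype ι] [DecidableEq ι]

def TraciallySymm (Q : QMS ι) : Prop :=
  ∀ t : ℝ, 0 ≤ t → ∀ x y : Mat ι, trn (Q.P t x * y) = trn (x * Q.P t y)

noncomputable def Gamma (L : Mat ι →ₗ[ℂ] Mat ι) (a b : Mat ι) : Mat ι :=
  (2:ℂ)⁻¹ • (aᴴ * L b + (L a)ᴴ * b - L (aᴴ * b))

noncomputable def Gamma2 (L : Mat ι →ₗ[ℂ] Mat ι) (a b : Mat ι) : Mat ι :=
  (2:ℂ)⁻¹ • (Gamma L a (L b) + Gamma L (L a) b - L (Gamma L a b))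

noncomputable def BE (L : Mat ι →ₗ[ℂ] Mat ι) (K ν : ℝ) : Prop :=
  ∀ a : Mat ι, matLE (K • Gamma L a a + ν • ((L a)ᴴ * (L a))) (Gamma2 L a a)

noncomputable def cK (K t : ℝ) : ℝ :=
  if K = 0 then 2 * t else (1 - Real.exp (-(2 * K * t))) / K

noncomputable def comm (v x : Mat ι) : Mat ι := v * x - x * v

def LindbladForm (L : Mat ι →ₗ[ℂ] Mat ι) {d : ℕ} (v : Fin d → Mat ι) : Prop :=
  (∀ j, ∃ k, (v j)ᴴ = v k) ∧ ∀ x, L x = ∑ j, comm ((v j)ᴴ) (comm (v j) x)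

def Intertwining (Q : QMS ι) {d : ℕ} (v : Fin d → Mat ι) (K : ℝ) : Prop :=
  ∀ t : ℝ, 0 ≤ t → ∀ (j : Fin d) (x : Mat ι),
    comm (v j) (Q.P t x) = Real.exp (-(K * t)) • Q.P t (comm (v j) x)

def CBE (L : Mat ι →ₗ[ℂ] Mat ι) (K ν : ℝ) : Prop :=
  ∀ (m : ℕ) (x : Fin m → Mat ι),
    (blockify (fun j k => Gamma2 L (x j) (x k)) -
      (K • blockify (fun j k => Gamma L (x j) (x k)) +
       ν • blockify (fun j k => (L (x j))ᴴ * (L (x k))))).PosSemidef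

def IsDensity (ρ : Mat ι) : Prop := ρ.PosSemidef ∧ trn ρ = 1

def IsInvDensity (ρ : Mat ι) : Prop := ρ.PosDef ∧ trn ρ = 1

def sliceL {κ : Type*} (x : Mat (ι × κ)) (a b : κ) : Mat ι :=
  Matrix.of fun i j => x (i, a) (j, b)

def sliceR {κ : Type*} (x : Mat (κ × ι)) (a b : κ) : Mat ι :=
  Matrix.of fun i j => x (a, i) (b, j)

noncomputable def lTensor (Φ : Mat ι →ₗ[ℂ] Mat ι) (κ : Type*) :
    Mat (ι × κ) →ₗ[ℂ] Mat (ι × κ) where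
  toFun x := Matrix.of fun p q => Φ (sliceL x p.2 q.2) p.1 q.1
  map_add' x y := by
    ext p q
    have h : sliceL (x + y) p.2 q.2 = sliceL x p.2 q.2 + sliceL y p.2 q.2 := rfl
    simp only [Matrix.of_apply, h, map_add, Matrix.add_apply]
  map_smul' c x := by
    ext p q
    have h : sliceL (c • x) p.2 q.2 = c • sliceL x p.2 q.2 := rfl
    simp only [Matrix.of_apply, h, _root_.map_smul, Matrix.smul_apply, RingHom.id_apply]

noncomputable def rTensor (Ψ : Mat ι →ₗ[ℂ] Mat ι) (κ : Type*) :
    Mat (κ × ι) →ₗ[ℂ] Mat (κ × ι) where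
  toFun x := Matrix.of fun p q => Ψ (sliceR x p.1 q.1) p.2 q.2
  map_add' x y := by
    ext p q
    have h : sliceR (x + y) p.1 q.1 = sliceR x p.1 q.1 + sliceR y p.1 q.1 := rfl
    simp only [Matrix.of_apply, h, map_add, Matrix.add_apply]
  map_smul' c x := by
    ext p q
    have h : sliceR (c • x) p.1 q.1 = c • sliceR x p.1 q.1 := rfl
    simp only [Matrix.of_apply, h, _root_.map_smul, Matrix.smul_apply, RingHom.id_apply]

end CD

namespace CD

theorem eq_sum_kronecker_single {ι κ : Type*} [Fintype κ] [DecidableEq κ]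
    (x : Mat (ι × κ)) :
    x = ∑ α : κ × κ, sliceL x α.1 α.2 ⊗ₖ Matrix.single α.1 α.2 (1 : ℂ) := by
  ext ⟨i, a⟩ ⟨j, b⟩
  simp [Matrix.sum_apply, Fintype.sum_prod_type, sliceL, Matrix.single_apply, ite_and]

section Kernels

variable {ι κ : Type*} [Fintype ι] [Fintype κ]

/-- A matrix-valued kernel is completely positive if all its Gram block matrices are positive
semidefinite. -/
def IsCPKernel (S : Mat ι → Mat ι → Mat ι) : Prop :=
  ∀ (m : ℕ) (x : Fin m → Mat ι), (blockify fun j k => S (x j) (x k)).PosSemidef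

theorem IsCPKernel.add {S T : Mat ι → Mat ι → Mat ι} (hS : IsCPKernel S) (hT : IsCPKernel T) :
    IsCPKernel fun a b => S a b + T a b :=
  fun m x => (hS m x).add (hT m x)

theorem IsCPKernel.smul {S : Mat ι → Mat ι → Mat ι} (hS : IsCPKernel S) {c : ℝ} (hc : 0 ≤ c) :
    IsCPKernel fun a b => c • S a b :=
  fun m x => (hS m x).smul hc

theorem isCPKernel_conjTranspose_mul (f : Mat ι → Mat ι) :
    IsCPKernel fun a b => (f a)ᴴ * f b := by
  intro m x
  convert Matrix.posSemidef_conjTranspose_mul_self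
    (Matrix.of fun (i : ι) (p : Fin m × ι) => f (x p.1) i p.2) using 1
  ext p q
  simp [blockify, Matrix.mul_apply]

theorem IsCPKernel.posSemidef {S : Mat ι → Mat ι → Mat ι} (hS : IsCPKernel S)
    {J : Type*} [Fintype J] (x : J → Mat ι) :
    (Matrix.of fun p q : J × ι => S (x p.1) (x q.1) p.2 q.2).PosSemidef := by
  let e := Fintype.equivFin J
  convert (hS _ (x ∘ e.symm)).submatrix (fun p : J × ι => (e p.1, p.2)) using 1
  ext p q
  simp [blockify]

theorem posSemidef_sum_blocks {J A H : Type*} [Fintype J] [Fintype A] [Fintype H]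
    {M : Matrix ((J × A) × H) ((J × A) × H) ℂ} (hM : M.PosSemidef) :
    (Matrix.of fun p q : J × H =>
      ∑ α, ∑ β, M ((p.1, α), p.2) ((q.1, β), q.2)).PosSemidef := by
  classical
  have h := hM.conjTranspose_mul_mul_same
    (Matrix.of fun (r : (J × A) × H) (p : J × H) =>
      if r.1.1 = p.1 ∧ r.2 = p.2 then (1 : ℂ) else 0)
  convert h using 1
  ext p q
  simp only [Matrix.mul_apply, Matrix.conjTranspose_apply, Matrix.of_apply,
    Fintype.sum_prod_type, ite_and]
  rw [Finset.sum_comm]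
  simp [apply_ite, Finset.sum_ite_eq']

theorem posSemidef_compress {p m : ℕ} {B : Fin p → Fin p → Mat ι}
    (hB : (blockify B).PosSemidef) (C : Fin p → Fin m → Mat ι) :
    (blockify fun j k => ∑ a, ∑ b, (C a j)ᴴ * B a b * C b k).PosSemidef := by
  convert hB.conjTranspose_mul_mul_same
    (Matrix.of fun (r : Fin p × ι) (q : Fin m × ι) => C r.1 q.1 r.2 q.2) using 1
  ext r q
  simp only [blockify, Matrix.mul_apply, Matrix.conjTranspose_apply, Matrix.of_apply,
    Fintype.sum_prod_type, Matrix.sum_apply, Finset.sum_mul]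
  rw [Finset.sum_comm]
  refine Finset.sum_congr rfl fun b _ => ?_
  rw [Finset.sum_comm]

variable [DecidableEq κ]

/-- A biadditive kernel on a tensor product which factors on elementary tensors into completely
positive kernels is completely positive. -/
theorem IsCPKernel.tensor {S₁ : Mat ι → Mat ι → Mat ι} {S₂ : Mat κ → Mat κ → Mat κ}
    (h₁ : IsCPKernel S₁) (h₂ : IsCPKernel S₂)
    {T : Mat (ι × κ) → Mat (ι × κ) → Mat (ι × κ)}
    (add_left : ∀ x y z, T (x + y) z = T x z + T y z)
    (add_right : ∀ x y z, T x (y + z) = T x y + T x z)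
    (hT : ∀ a b c d, T (a ⊗ₖ b) (c ⊗ₖ d) = S₁ a c ⊗ₖ S₂ b d) : IsCPKernel T := by
  have key : ∀ x y, T x y = ∑ α : κ × κ, ∑ β : κ × κ,
      S₁ (sliceL x α.1 α.2) (sliceL y β.1 β.2) ⊗ₖ
        S₂ (Matrix.single α.1 α.2 1) (Matrix.single β.1 β.2 1) := by
    intro x y
    have hl : ∀ z (f : κ × κ → Mat (ι × κ)), T (∑ α, f α) z = ∑ α, T (f α) z := fun z f =>
      map_sum (AddMonoidHom.mk' (fun x => T x z) fun x y => add_left x y z) f Finset.univ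
    have hr : ∀ z (f : κ × κ → Mat (ι × κ)), T z (∑ α, f α) = ∑ α, T z (f α) := fun z f =>
      map_sum (AddMonoidHom.mk' (T z) (add_right z)) f Finset.univ
    conv_lhs => rw [eq_sum_kronecker_single x, eq_sum_kronecker_single y]
    simp only [hl, hr, hT]
  intro m x
  have hk := ((h₁.posSemidef fun r : Fin m × (κ × κ) => sliceL (x r.1) r.2.1 r.2.2).kronecker
    (h₂.posSemidef fun r : Fin m × (κ × κ) => Matrix.single r.2.1 r.2.2 (1 : ℂ))).submatrix
      (fun r : (Fin m × (κ × κ)) × (ι × κ) => ((r.1, r.2.1), (r.1, r.2.2)))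
  convert posSemidef_sum_blocks hk using 1
  ext p q
  simp [blockify, key, Matrix.sum_apply]

end Kernels

section Gamma

variable {ι : Type*} [Fintype ι]

theorem Gamma_add_left (L : Mat ι →ₗ[ℂ] Mat ι) (x y z : Mat ι) :
    Gamma L (x + y) z = Gamma L x z + Gamma L y z := by
  simp only [Gamma, Matrix.conjTranspose_add, map_add, Matrix.add_mul]
  module

theorem Gamma_add_right (L : Mat ι →ₗ[ℂ] Mat ι) (x y z : Mat ι) :
    Gamma L x (y + z) = Gamma L x y + Gamma L x z := by
  simp only [Gamma, map_add, Matrix.mul_add]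
  module

/-- The mixed iterated carré du champ of two generators. -/
noncomputable def mixedGamma (A B : Mat ι →ₗ[ℂ] Mat ι) (a b : Mat ι) : Mat ι :=
  (2 : ℂ)⁻¹ • (Gamma A a (B b) + Gamma A (B a) b - B (Gamma A a b))

theorem mixedGamma_self (A : Mat ι →ₗ[ℂ] Mat ι) : mixedGamma A A = Gamma2 A := rfl

theorem mixedGamma_add_left (A B : Mat ι →ₗ[ℂ] Mat ι) (x y z : Mat ι) :
    mixedGamma A B (x + y) z = mixedGamma A B x z + mixedGamma A B y z := by
  simp only [mixedGamma, Gamma_add_left, map_add]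
  module

theorem mixedGamma_add_right (A B : Mat ι →ₗ[ℂ] Mat ι) (x y z : Mat ι) :
    mixedGamma A B x (y + z) = mixedGamma A B x y + mixedGamma A B x z := by
  simp only [mixedGamma, Gamma_add_right, map_add]
  module

theorem Gamma_add (A B : Mat ι →ₗ[ℂ] Mat ι) (x y : Mat ι) :
    Gamma (A + B) x y = Gamma A x y + Gamma B x y := by
  simp only [Gamma, LinearMap.add_apply, Matrix.conjTranspose_add, Matrix.add_mul, Matrix.mul_add]
  module

theorem Gamma2_add (A B : Mat ι →ₗ[ℂ] Mat ι) (x y : Mat ι) :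
    Gamma2 (A + B) x y =
      Gamma2 A x y + Gamma2 B x y + mixedGamma A B x y + mixedGamma B A x y := by
  simp only [Gamma2, mixedGamma, Gamma_add, Gamma_add_left, Gamma_add_right, LinearMap.add_apply,
    map_add]
  module

/-- The defect kernel of the complete Bakry–Émery inequality. -/
noncomputable def curvatureDefect (L : Mat ι →ₗ[ℂ] Mat ι) (K ν : ℝ) (a b : Mat ι) : Mat ι :=
  Gamma2 L a b - (K • Gamma L a b + ν • ((L a)ᴴ * L b))

theorem CBE_iff_isCPKernel [DecidableEq ι] (L : Mat ι →ₗ[ℂ] Mat ι) (K ν : ℝ) :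
    CBE L K ν ↔ IsCPKernel (curvatureDefect L K ν) :=
  Iff.rfl

theorem curvatureDefect_add_left (L : Mat ι →ₗ[ℂ] Mat ι) (K ν : ℝ) (x y z : Mat ι) :
    curvatureDefect L K ν (x + y) z = curvatureDefect L K ν x z + curvatureDefect L K ν y z := by
  simp only [curvatureDefect, ← mixedGamma_self, mixedGamma_add_left, Gamma_add_left, map_add,
    Matrix.conjTranspose_add, Matrix.add_mul]
  module

theorem curvatureDefect_add_right (L : Mat ι →ₗ[ℂ] Mat ι) (K ν : ℝ) (x y z : Mat ι) :
    curvatureDefect L K ν x (y + z) = curvatureDefect L K ν x y + curvatureDefect L K ν x z := by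
  simp only [curvatureDefect, ← mixedGamma_self, mixedGamma_add_right, Gamma_add_right, map_add,
    Matrix.mul_add]
  module

theorem tendsto_Gamma {X : Type*} {l : Filter X} {D : X → Mat ι →ₗ[ℂ] Mat ι}
    {L : Mat ι →ₗ[ℂ] Mat ι} (h : ∀ x, Tendsto (fun t => D t x) l (nhds (L x))) (a b : Mat ι) :
    Tendsto (fun t => Gamma (D t) a b) l (nhds (Gamma L a b)) := by
  have h1 : Tendsto (fun t => aᴴ * D t b) l (nhds (aᴴ * L b)) :=
    ((continuous_const.matrix_mul continuous_id).tendsto (L b)).comp (h b)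
  have h2 : Tendsto (fun t => (D t a)ᴴ * b) l (nhds ((L a)ᴴ * b)) :=
    ((continuous_id.matrix_conjTranspose.matrix_mul continuous_const).tendsto (L a)).comp (h a)
  have h3 := (h1.add h2).sub (h (aᴴ * b))
  exact h3.const_smul (2 : ℂ)⁻¹

end Gamma

section Semigroup

variable {ι : Type*} [Fintype ι] [DecidableEq ι]

theorem IsCP.map_conjTranspose {Φ : Mat ι →ₗ[ℂ] Mat ι} (hΦ : IsCP Φ) (x : Mat ι) :
    Φ xᴴ = (Φ x)ᴴ := by
  have h := (hΦ 2 _ (isCPKernel_conjTranspose_mul id 2 ![1, x])).isHermitian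
  ext i j
  simpa [blockify] using (h.apply (1, i) (0, j)).symm

theorem IsCP.isCPKernel_Gamma_id_sub {Φ : Mat ι →ₗ[ℂ] Mat ι} (hΦ : IsCP Φ) (h1 : Φ 1 = 1) :
    IsCPKernel (Gamma (LinearMap.id - Φ)) := by
  intro m x
  have h := posSemidef_compress
    (hΦ (m + 1) _ (isCPKernel_conjTranspose_mul id (m + 1) (Fin.cons 1 x)))
    (Fin.cons (fun k => -x k) fun a k => if a = k then 1 else 0)
  convert h.smul (by norm_num : (0 : ℝ) ≤ 2⁻¹) using 1
  have e : ∀ j k, Gamma (LinearMap.id - Φ) (x j) (x k) = (2⁻¹ : ℝ) •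
      (Φ ((x j)ᴴ * x k) - (Φ (x j))ᴴ * x k - (x j)ᴴ * Φ (x k) + (x j)ᴴ * x k) := by
    intro j k
    simp only [Gamma, LinearMap.sub_apply, LinearMap.id_apply, Matrix.conjTranspose_sub,
      Matrix.mul_sub, Matrix.sub_mul]
    rw [← Complex.coe_smul]
    push_cast
    module
  ext ⟨j, i⟩ ⟨k, l⟩
  simp only [blockify, Matrix.of_apply, Matrix.smul_apply, e]
  congr 1
  simp only [Fin.sum_univ_succ, Fin.cons_zero, Fin.cons_succ, id, apply_ite conjTranspose,
    Matrix.conjTranspose_one, Matrix.conjTranspose_zero, ite_mul, mul_ite, Matrix.one_mul,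
    Matrix.mul_one, Matrix.zero_mul, Matrix.mul_zero, Finset.sum_ite_eq', Finset.mem_univ,
    if_true, h1, hΦ.map_conjTranspose, Finset.sum_add_distrib, Matrix.conjTranspose_neg,
    Matrix.neg_mul, Matrix.mul_neg, Finset.sum_neg_distrib]
  simp only [Matrix.add_apply, Matrix.sub_apply, Matrix.neg_apply]
  ring

theorem posSemidef_of_tendsto {J X : Type*} [Fintype J] {l : Filter X} [l.NeBot]
    {F : X → Matrix J J ℂ} {M : Matrix J J ℂ} (hF : ∀ᶠ t in l, (F t).PosSemidef)
    (h : Tendsto F l (nhds M)) : M.PosSemidef := by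
  rw [Matrix.posSemidef_iff_dotProduct_mulVec]
  constructor
  · refine tendsto_nhds_unique (((continuous_id.matrix_conjTranspose.tendsto M).comp h).congr' ?_) h
    filter_upwards [hF] with t ht using ht.isHermitian
  · intro v
    have hc : Continuous fun A : Matrix J J ℂ => star v ⬝ᵥ (A *ᵥ v) := by fun_prop
    refine ge_of_tendsto ((hc.tendsto M).comp h) ?_
    filter_upwards [hF] with t ht using ht.dotProduct_mulVec_nonneg v

theorem QMS.tendsto_gen (Q : QMS ι) (x : Mat ι) :
    Tendsto (fun t : ℝ => (t⁻¹ • (LinearMap.id - Q.P t) : Mat ι →ₗ[ℂ] Mat ι) x) (nhdsWithin 0 (Set.Ioi 0))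
      (nhds (Q.gen x)) := by
  refine tendsto_pi_nhds.2 fun i => tendsto_pi_nhds.2 fun j => ?_
  have h := ((Q.P_deriv x i j).tendsto_slope_zero_right).neg
  simp only [neg_neg, zero_add, Q.P_zero] at h
  refine h.congr fun t => ?_
  simp [mul_sub]

theorem QMS.isCPKernel_Gamma (Q : QMS ι) : IsCPKernel (Gamma Q.gen) := by
  intro m x
  refine posSemidef_of_tendsto (l := nhdsWithin (0 : ℝ) (Set.Ioi 0))
    (F := fun t => blockify fun j k => Gamma (t⁻¹ • (LinearMap.id - Q.P t)) (x j) (x k)) ?_ ?_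
  · filter_upwards [self_mem_nhdsWithin] with t ht
    have ht' : (0 : ℝ) < t := ht
    have h := ((Q.P_cp t ht'.le).isCPKernel_Gamma_id_sub (Q.P_unital t ht'.le)).smul
      (inv_nonneg.2 ht'.le) m x
    convert h using 4 with j k
    simp only [Gamma, LinearMap.smul_apply, Matrix.conjTranspose_smul, star_trivial,
      Matrix.mul_smul, Matrix.smul_mul, ← smul_add, ← smul_sub]
    rw [smul_comm]
  · refine tendsto_pi_nhds.2 fun p => tendsto_pi_nhds.2 fun q => ?_
    have h := tendsto_Gamma Q.tendsto_gen (x p.1) (x q.1)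
    exact tendsto_pi_nhds.1 (tendsto_pi_nhds.1 h p.2) q.2

end Semigroup

section Tensor

variable {ι κ : Type*}

theorem lTensor_kronecker (Φ : Mat ι →ₗ[ℂ] Mat ι) (a : Mat ι) (b : Mat κ) :
    lTensor Φ κ (a ⊗ₖ b) = Φ a ⊗ₖ b := by
  ext p q
  have h : sliceL (a ⊗ₖ b) p.2 q.2 = b p.2 q.2 • a := by
    ext i j
    simp [sliceL, mul_comm]
  simp [lTensor, h, mul_comm]

theorem rTensor_kronecker (Ψ : Mat κ →ₗ[ℂ] Mat κ) (a : Mat ι) (b : Mat κ) :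
    rTensor Ψ ι (a ⊗ₖ b) = a ⊗ₖ Ψ b := by
  ext p q
  have h : sliceR (a ⊗ₖ b) p.1 q.1 = a p.1 q.1 • b := by
    ext i j
    simp [sliceR]
  simp [rTensor, h]

variable [Fintype ι] [Fintype κ]

theorem Gamma_lTensor_kronecker (Φ : Mat ι →ₗ[ℂ] Mat ι) (a c : Mat ι) (b d : Mat κ) :
    Gamma (lTensor Φ κ) (a ⊗ₖ b) (c ⊗ₖ d) = Gamma Φ a c ⊗ₖ (bᴴ * d) := by
  simp only [Gamma, lTensor_kronecker, Matrix.conjTranspose_kronecker,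
    ← Matrix.mul_kronecker_mul]
  ext p q
  simp
  ring

theorem Gamma_rTensor_kronecker (Ψ : Mat κ →ₗ[ℂ] Mat κ) (a c : Mat ι) (b d : Mat κ) :
    Gamma (rTensor Ψ ι) (a ⊗ₖ b) (c ⊗ₖ d) = (aᴴ * c) ⊗ₖ Gamma Ψ b d := by
  simp only [Gamma, rTensor_kronecker, Matrix.conjTranspose_kronecker,
    ← Matrix.mul_kronecker_mul]
  ext p q
  simp
  ring

theorem mixedGamma_lTensor_rTensor_kronecker (Φ : Mat ι →ₗ[ℂ] Mat ι) (Ψ : Mat κ →ₗ[ℂ] Mat κ)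
    (a c : Mat ι) (b d : Mat κ) :
    mixedGamma (lTensor Φ κ) (rTensor Ψ ι) (a ⊗ₖ b) (c ⊗ₖ d) = Gamma Φ a c ⊗ₖ Gamma Ψ b d := by
  simp only [mixedGamma, rTensor_kronecker, Gamma_lTensor_kronecker]
  rw [Gamma.eq_def Ψ]
  ext p q
  simp
  ring

theorem mixedGamma_rTensor_lTensor_kronecker (Φ : Mat ι →ₗ[ℂ] Mat ι) (Ψ : Mat κ →ₗ[ℂ] Mat κ)
    (a c : Mat ι) (b d : Mat κ) :
    mixedGamma (rTensor Ψ ι) (lTensor Φ κ) (a ⊗ₖ b) (c ⊗ₖ d) = Gamma Φ a c ⊗ₖ Gamma Ψ b d := by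
  simp only [mixedGamma, lTensor_kronecker, Gamma_rTensor_kronecker]
  rw [Gamma.eq_def Φ]
  ext p q
  simp
  ring

theorem curvatureDefect_lTensor_kronecker (Φ : Mat ι →ₗ[ℂ] Mat ι) (K ν : ℝ)
    (a c : Mat ι) (b d : Mat κ) :
    curvatureDefect (lTensor Φ κ) K ν (a ⊗ₖ b) (c ⊗ₖ d) =
      curvatureDefect Φ K ν a c ⊗ₖ (bᴴ * d) := by
  simp only [curvatureDefect, Gamma2, lTensor_kronecker, Gamma_lTensor_kronecker,
    Matrix.conjTranspose_kronecker, ← Matrix.mul_kronecker_mul]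
  ext p q
  simp
  ring

theorem curvatureDefect_rTensor_kronecker (Ψ : Mat κ →ₗ[ℂ] Mat κ) (K ν : ℝ)
    (a c : Mat ι) (b d : Mat κ) :
    curvatureDefect (rTensor Ψ ι) K ν (a ⊗ₖ b) (c ⊗ₖ d) =
      (aᴴ * c) ⊗ₖ curvatureDefect Ψ K ν b d := by
  simp only [curvatureDefect, Gamma2, rTensor_kronecker, Gamma_rTensor_kronecker,
    Matrix.conjTranspose_kronecker, ← Matrix.mul_kronecker_mul]
  ext p q
  simp
  ring

end Tensor

section Dimension

variable {ι : Type*} [Fintype ι]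

/-- Convexity of `x ↦ x* x` in the form adapted to adding dimensions. -/
theorem isCPKernel_dimension_add {N N' : ℝ≥0∞} (hN : 0 < N) (hN' : 0 < N')
    (A B : Mat ι →ₗ[ℂ] Mat ι) :
    IsCPKernel fun a b => N⁻¹.toReal • ((A a)ᴴ * A b) + N'⁻¹.toReal • ((B a)ᴴ * B b) -
      (N + N')⁻¹.toReal • (((A + B) a)ᴴ * (A + B) b) := by
  by_cases h : N = ⊤ ∨ N' = ⊤
  · have h0 : (N + N')⁻¹.toReal = 0 := by rcases h with h | h <;> simp [h]
    simp only [h0, zero_smul, sub_zero]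
    exact ((isCPKernel_conjTranspose_mul A).smul ENNReal.toReal_nonneg).add
      ((isCPKernel_conjTranspose_mul B).smul ENNReal.toReal_nonneg)
  · push Not at h
    obtain ⟨r, hr⟩ : ∃ r, N.toReal = r := ⟨_, rfl⟩
    obtain ⟨s, hs⟩ : ∃ s, N'.toReal = s := ⟨_, rfl⟩
    have hr0 : 0 < r := hr ▸ ENNReal.toReal_pos hN.ne' h.1
    have hs0 : 0 < s := hs ▸ ENNReal.toReal_pos hN'.ne' h.2
    convert (isCPKernel_conjTranspose_mul fun a => s • A a - r • B a).smul
      (show 0 ≤ (r * s * (r + s))⁻¹ by positivity) using 3 with a b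
    simp only [ENNReal.toReal_inv, ENNReal.toReal_add h.1 h.2, hr, hs, LinearMap.add_apply,
      Matrix.conjTranspose_add, Matrix.conjTranspose_sub, Matrix.conjTranspose_smul,
      star_trivial, Matrix.add_mul, Matrix.mul_add, Matrix.sub_mul, Matrix.mul_sub,
      Matrix.smul_mul, Matrix.mul_smul]
    match_scalars <;> field_simp <;> ring

end Dimension

/-- If tracially symmetric quantum Markov semigroups on `M_{n₁}(ℂ)`
and `M_{n₂}(ℂ)` satisfy `CBE(K,N)` and `CBE(K',N')` respectively, then the tensor
product semigroup on `M_{n₁}(ℂ) ⊗ M_{n₂}(ℂ)`, whose generator is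
`L_P ⊗ id + id ⊗ L_Q`, satisfies `CBE(min{K,K'}, N+N')`. -/
theorem CBE_tensor {n₁ n₂ : ℕ} (Q₁ : QMS (Fin n₁)) (Q₂ : QMS (Fin n₂))
    (hsymm₁ : TraciallySymm Q₁) (hsymm₂ : TraciallySymm Q₂)
    (K K' : ℝ) (N N' : ℝ≥0∞) (hN : 0 < N) (hN' : 0 < N')
    (hQ₁ : CBE Q₁.gen K N⁻¹.toReal) (hQ₂ : CBE Q₂.gen K' N'⁻¹.toReal) :
    CBE (lTensor Q₁.gen (Fin n₂) + rTensor Q₂.gen (Fin n₁))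
      (min K K') ((N + N')⁻¹.toReal) := by
  rw [CBE_iff_isCPKernel] at *
  set A := lTensor Q₁.gen (Fin n₂)
  set B := rTensor Q₂.gen (Fin n₁)
  have hΓA : IsCPKernel (Gamma A) := Q₁.isCPKernel_Gamma.tensor (isCPKernel_conjTranspose_mul id)
    (Gamma_add_left A) (Gamma_add_right A) fun a b c d => Gamma_lTensor_kronecker _ a c b d
  have hΓB : IsCPKernel (Gamma B) := (isCPKernel_conjTranspose_mul id).tensor Q₂.isCPKernel_Gamma
    (Gamma_add_left B) (Gamma_add_right B) fun a b c d => Gamma_rTensor_kronecker _ a c b d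
  have hAB : IsCPKernel (mixedGamma A B) := Q₁.isCPKernel_Gamma.tensor Q₂.isCPKernel_Gamma
    (mixedGamma_add_left A B) (mixedGamma_add_right A B)
    fun a b c d => mixedGamma_lTensor_rTensor_kronecker _ _ a c b d
  have hBA : IsCPKernel (mixedGamma B A) := Q₁.isCPKernel_Gamma.tensor Q₂.isCPKernel_Gamma
    (mixedGamma_add_left B A) (mixedGamma_add_right B A)
    fun a b c d => mixedGamma_rTensor_lTensor_kronecker _ _ a c b d
  have hCA : IsCPKernel (curvatureDefect A K N⁻¹.toReal) :=
    hQ₁.tensor (isCPKernel_conjTranspose_mul id) (curvatureDefect_add_left A _ _)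
      (curvatureDefect_add_right A _ _)
      fun a b c d => curvatureDefect_lTensor_kronecker _ _ _ a c b d
  have hCB : IsCPKernel (curvatureDefect B K' N'⁻¹.toReal) :=
    (isCPKernel_conjTranspose_mul id).tensor hQ₂ (curvatureDefect_add_left B _ _)
      (curvatureDefect_add_right B _ _)
      fun a b c d => curvatureDefect_rTensor_kronecker _ _ _ a c b d
  have h := ((((hCA.add hCB).add (hAB.add hBA)).add
    (hΓA.smul (sub_nonneg.2 (min_le_left K K')))).add
      (hΓB.smul (sub_nonneg.2 (min_le_right K K')))).add (isCPKernel_dimension_add hN hN' A B)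
  convert h using 3 with a b
  simp only [curvatureDefect, Gamma2_add, Gamma_add]
  module

end CD
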